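/- For all integers i, j ≥ 0 and all t ≥ 1 one has N_i(t) N_j(t) ≤ N₀(t) N_{i+j}(t), and N_i(t) Q_j(t) ≤ h(t) N_{i+j}(t) ≤ N_{i+j+1}(t). (Inequalities (3.78) and (3.79) of Lemma 3.8.) -/

import Mathlib

open MeasureTheory

/-- `h(t) = ∫₁^∞ max(t, t₁)⁻¹ h₀′(t₁) dt₁`. -/
noncomputable def hFun (h₀' : ℝ → ℝ) (t : ℝ) : ℝ :=
  ∫ t₁ in Set.Ici (1 : ℝ), (max t t₁)⁻¹ * h₀' t₁

/-- `N_m(t) = ∫₁^t h₀′(t₁) h(t₁)^m dt₁`. -/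
noncomputable def NFun (h₀' : ℝ → ℝ) (m : ℕ) (t : ℝ) : ℝ :=
  ∫ t₁ in (1 : ℝ)..t, h₀' t₁ * hFun h₀' t₁ ^ m

/-- `Q_m(t) = ∫₁^∞ max(t, t₁)⁻¹ h₀′(t₁) h(t₁)^m dt₁`. -/
noncomputable def QFun (h₀' : ℝ → ℝ) (m : ℕ) (t : ℝ) : ℝ :=
  ∫ t₁ in Set.Ici (1 : ℝ), (max t t₁)⁻¹ * h₀' t₁ * hFun h₀' t₁ ^ m

/-- Chebyshev's integral inequality: similarly ordered functions are positively correlated with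
respect to any nonnegative weight. -/
theorem integral_mul_integral_le_of_monovary {α : Type*} [MeasurableSpace α] {μ : Measure α}
    {w f g : α → ℝ} {s : Set α} (hs : MeasurableSet s) (hw : ∀ x ∈ s, 0 ≤ w x)
    (hfg : ∀ x ∈ s, ∀ y ∈ s, 0 ≤ (f x - f y) * (g x - g y))
    (iw : IntegrableOn w s μ) (iwf : IntegrableOn (fun x => w x * f x) s μ)
    (iwg : IntegrableOn (fun x => w x * g x) s μ)
    (iwfg : IntegrableOn (fun x => w x * (f x * g x)) s μ) :
    (∫ x in s, w x * f x ∂μ) * (∫ x in s, w x * g x ∂μ) ≤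
      (∫ x in s, w x ∂μ) * ∫ x in s, w x * (f x * g x) ∂μ := by
  set W := ∫ x in s, w x ∂μ with hW
  set F := ∫ x in s, w x * f x ∂μ with hF
  set G := ∫ x in s, w x * g x ∂μ with hG
  set P := ∫ x in s, w x * (f x * g x) ∂μ with hP
  have expand : ∀ a b c d : ℝ,
      ∫ x in s, (a * (w x * (f x * g x)) - b * (w x * f x) - c * (w x * g x) + d * w x) ∂μ =
        a * P - b * F - c * G + d * W := by
    intro a b c d
    have i1 : Integrable (fun x => a * (w x * (f x * g x)) - b * (w x * f x)) (μ.restrict s) :=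
      (iwfg.const_mul a).sub (iwf.const_mul b)
    have i2 : Integrable (fun x => a * (w x * (f x * g x)) - b * (w x * f x) - c * (w x * g x))
        (μ.restrict s) := i1.sub (iwg.const_mul c)
    rw [integral_add i2 (iw.const_mul d), integral_sub i1 (iwg.const_mul c),
      integral_sub (iwfg.const_mul a) (iwf.const_mul b)]
    simp only [integral_const_mul, hW, hF, hG, hP]
  have inner : ∀ y ∈ s, 0 ≤ 1 * P - g y * F - f y * G + f y * g y * W := by
    intro y hy
    rw [← expand]
    refine setIntegral_nonneg hs fun x hx => ?_
    have := mul_nonneg (hw x hx) (hfg x hx y hy)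
    linarith
  have outer : 0 ≤ W * P - G * F - F * G + P * W := by
    have h1 : 0 ≤ ∫ y in s,
        (W * (w y * (f y * g y)) - G * (w y * f y) - F * (w y * g y) + P * w y) ∂μ := by
      refine setIntegral_nonneg hs fun y hy => ?_
      have := mul_nonneg (hw y hy) (inner y hy)
      linarith
    rwa [expand] at h1
  linarith

theorem integrableOn_inv_max_mul {w : ℝ → ℝ} (hw : ∀ t ∈ Set.Ici (1 : ℝ), 0 ≤ w t)
    (hcont : ContinuousOn w (Set.Ici 1))
    (hint : IntegrableOn (fun t => t⁻¹ * w t) (Set.Ici 1)) (t : ℝ) :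
    IntegrableOn (fun s => (max t s)⁻¹ * w s) (Set.Ici 1) := by
  refine Integrable.mono' hint ?_ ?_
  · exact (by fun_prop : Measurable fun s : ℝ => (max t s)⁻¹).aestronglyMeasurable.mul
      (hcont.aestronglyMeasurable measurableSet_Ici)
  · refine (ae_restrict_iff' measurableSet_Ici).2 (ae_of_all _ fun s hs => ?_)
    have hs0 : (0 : ℝ) < s := lt_of_lt_of_le one_pos hs
    have hm : 0 < max t s := lt_max_of_lt_right hs0
    rw [Real.norm_of_nonneg (mul_nonneg (inv_nonneg.2 hm.le) (hw s hs))]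
    exact mul_le_mul_of_nonneg_right (inv_anti₀ hs0 (le_max_right _ _)) (hw s hs)

theorem hFun_nonneg {w : ℝ → ℝ} (hw : ∀ t ∈ Set.Ici (1 : ℝ), 0 ≤ w t) (t : ℝ) :
    0 ≤ hFun w t := by
  refine setIntegral_nonneg measurableSet_Ici fun s hs => mul_nonneg (inv_nonneg.2 ?_) (hw s hs)
  exact le_max_of_le_right (zero_le_one.trans hs)

theorem hFun_antitone {w : ℝ → ℝ} (hw : ∀ t ∈ Set.Ici (1 : ℝ), 0 ≤ w t)
    (hcont : ContinuousOn w (Set.Ici 1))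
    (hint : IntegrableOn (fun t => t⁻¹ * w t) (Set.Ici 1)) : Antitone (hFun w) := by
  intro a b hab
  refine setIntegral_mono_on (integrableOn_inv_max_mul hw hcont hint b)
    (integrableOn_inv_max_mul hw hcont hint a) measurableSet_Ici fun s hs => ?_
  have hs0 : (0 : ℝ) < s := lt_of_lt_of_le one_pos hs
  exact mul_le_mul_of_nonneg_right
    (inv_anti₀ (lt_max_of_lt_right hs0) (max_le_max_right s hab)) (hw s hs)

theorem hFun_pow_antitone {w : ℝ → ℝ} (hw : ∀ t ∈ Set.Ici (1 : ℝ), 0 ≤ w t)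
    (hcont : ContinuousOn w (Set.Ici 1))
    (hint : IntegrableOn (fun t => t⁻¹ * w t) (Set.Ici 1)) (m : ℕ) :
    Antitone fun t => hFun w t ^ m :=
  fun _ b hab => pow_le_pow_left₀ (hFun_nonneg hw b) (hFun_antitone hw hcont hint hab) m

theorem integrableOn_mul_hFun_pow {w v : ℝ → ℝ} (hw : ∀ t ∈ Set.Ici (1 : ℝ), 0 ≤ w t)
    (hcont : ContinuousOn w (Set.Ici 1))
    (hint : IntegrableOn (fun t => t⁻¹ * w t) (Set.Ici 1)) {s : Set ℝ} (hs : MeasurableSet s)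
    (hs1 : s ⊆ Set.Ici 1) (hv : IntegrableOn v s) (m : ℕ) :
    IntegrableOn (fun t => v t * hFun w t ^ m) s := by
  refine Integrable.mul_bdd (c := hFun w 1 ^ m) hv
    (hFun_pow_antitone hw hcont hint m).measurable.aestronglyMeasurable ?_
  refine (ae_restrict_iff' hs).2 (ae_of_all _ fun x hx => ?_)
  rw [Real.norm_of_nonneg (pow_nonneg (hFun_nonneg hw x) m)]
  exact hFun_pow_antitone hw hcont hint m (hs1 hx)

theorem hFun_eq_QFun_zero (w : ℝ → ℝ) (t : ℝ) : hFun w t = QFun w 0 t := by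
  simp [hFun, QFun]

theorem NFun_eq_setIntegral (w : ℝ → ℝ) (m : ℕ) {t : ℝ} (ht : 1 ≤ t) :
    NFun w m t = ∫ s in Set.Ioc 1 t, w s * hFun w s ^ m :=
  intervalIntegral.integral_of_le ht

theorem QFun_eq_add {w : ℝ → ℝ} (hw : ∀ t ∈ Set.Ici (1 : ℝ), 0 ≤ w t)
    (hcont : ContinuousOn w (Set.Ici 1))
    (hint : IntegrableOn (fun t => t⁻¹ * w t) (Set.Ici 1)) (m : ℕ) {t : ℝ} (ht : 1 ≤ t) :
    QFun w m t = t⁻¹ * NFun w m t + ∫ s in Set.Ioi t, s⁻¹ * w s * hFun w s ^ m := by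
  have hi := integrableOn_mul_hFun_pow hw hcont hint measurableSet_Ici subset_rfl
    (integrableOn_inv_max_mul hw hcont hint t) m
  rw [QFun, integral_Ici_eq_integral_Ioi, ← Set.Ioc_union_Ioi_eq_Ioi ht,
    setIntegral_union (Set.Ioc_disjoint_Ioi le_rfl) measurableSet_Ioi
      (hi.mono_set fun s hs => hs.1.le) (hi.mono_set fun s hs => ht.trans (le_of_lt hs)),
    NFun_eq_setIntegral w m ht, ← integral_const_mul]
  congr 1
  · refine setIntegral_congr_fun measurableSet_Ioc fun s hs => ?_
    simp only [max_eq_left hs.2, mul_assoc]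
  · refine setIntegral_congr_fun measurableSet_Ioi fun s hs => ?_
    simp only [max_eq_right (le_of_lt (Set.mem_Ioi.1 hs))]

/-- Inequalities (3.78) and (3.79) of Lemma 3.8: for integers `i, j ≥ 0` and `t ≥ 1`,
`N_i(t) N_j(t) ≤ N₀(t) N_{i+j}(t)` and `N_i(t) Q_j(t) ≤ h(t) N_{i+j}(t) ≤ N_{i+j+1}(t)`. -/
theorem stmt13 (h₀ h₀' : ℝ → ℝ)
    (hderiv : ∀ t ∈ Set.Ici (1 : ℝ), HasDerivWithinAt h₀ (h₀' t) (Set.Ici 1) t)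
    (hcont : ContinuousOn h₀' (Set.Ici 1))
    (h₀nonneg : ∀ t ∈ Set.Ici (1 : ℝ), 0 ≤ h₀ t)
    (h₀'nonneg : ∀ t ∈ Set.Ici (1 : ℝ), 0 ≤ h₀' t)
    (hint₀ : IntegrableOn (fun t => (t ^ 2)⁻¹ * h₀ t) (Set.Ici 1))
    (hint' : IntegrableOn (fun t => t⁻¹ * h₀' t) (Set.Ici 1))
    (i j : ℕ) (t : ℝ) (ht : 1 ≤ t) :
    NFun h₀' i t * NFun h₀' j t ≤ NFun h₀' 0 t * NFun h₀' (i + j) t ∧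
    NFun h₀' i t * QFun h₀' j t ≤ hFun h₀' t * NFun h₀' (i + j) t ∧
    hFun h₀' t * NFun h₀' (i + j) t ≤ NFun h₀' (i + j + 1) t := by
  have hQ := fun m => QFun_eq_add h₀'nonneg hcont hint' m ht
  have hpow := hFun_pow_antitone h₀'nonneg hcont hint'
  have hpos := hFun_nonneg h₀'nonneg
  have hw : ∀ s ∈ Set.Ioc 1 t, 0 ≤ h₀' s := fun s hs => h₀'nonneg s hs.1.le
  have iw : IntegrableOn h₀' (Set.Ioc 1 t) :=
    ((hcont.mono Set.Icc_subset_Ici_self).integrableOn_Icc).mono_set Set.Ioc_subset_Icc_self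
  have iN : ∀ m, IntegrableOn (fun s => h₀' s * hFun h₀' s ^ m) (Set.Ioc 1 t) :=
    integrableOn_mul_hFun_pow h₀'nonneg hcont hint' measurableSet_Ioc (fun s hs => hs.1.le) iw
  have hN0 : ∀ m, 0 ≤ NFun h₀' m t := fun m => by
    rw [NFun_eq_setIntegral _ _ ht]
    exact setIntegral_nonneg measurableSet_Ioc fun s hs =>
      mul_nonneg (hw s hs) (pow_nonneg (hpos s) m)
  have step : ∀ m k, hFun h₀' t ^ k * NFun h₀' m t ≤ NFun h₀' (m + k) t := fun m k => by
    rw [NFun_eq_setIntegral _ _ ht, NFun_eq_setIntegral _ _ ht, ← integral_const_mul]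
    refine setIntegral_mono_on ((iN m).const_mul _) (iN (m + k)) measurableSet_Ioc fun s hs => ?_
    have h1 := mul_le_mul_of_nonneg_left (hpow k hs.2)
      (mul_nonneg (hw s hs) (pow_nonneg (hpos s) m))
    rw [pow_add]
    linarith
  have cheb : NFun h₀' i t * NFun h₀' j t ≤ NFun h₀' 0 t * NFun h₀' (i + j) t := by
    simp only [NFun_eq_setIntegral _ _ ht, pow_zero, mul_one, pow_add]
    refine integral_mul_integral_le_of_monovary measurableSet_Ioc hw (fun x _ y _ => ?_) iw
      (iN i) (iN j) (by simpa only [pow_add] using iN (i + j))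
    rcases le_total x y with hxy | hxy
    · exact mul_nonneg (sub_nonneg.2 (hpow i hxy)) (sub_nonneg.2 (hpow j hxy))
    · exact mul_nonneg_of_nonpos_of_nonpos (sub_nonpos.2 (hpow i hxy))
        (sub_nonpos.2 (hpow j hxy))
  refine ⟨cheb, ?_, by simpa using step (i + j) 1⟩
  have hsub : Set.Ioi t ⊆ Set.Ici 1 := fun s hs => ht.trans (le_of_lt hs)
  have iv : IntegrableOn (fun s => s⁻¹ * h₀' s) (Set.Ioi t) := hint'.mono_set hsub
  have hv : ∀ s ∈ Set.Ioi t, 0 ≤ s⁻¹ * h₀' s := fun s hs =>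
    mul_nonneg (inv_nonneg.2 (zero_le_one.trans (hsub hs))) (h₀'nonneg s (hsub hs))
  have tail : ∫ s in Set.Ioi t, s⁻¹ * h₀' s * hFun h₀' s ^ j ≤
      hFun h₀' t ^ j * ∫ s in Set.Ioi t, s⁻¹ * h₀' s := by
    rw [← integral_const_mul]
    refine setIntegral_mono_on (integrableOn_mul_hFun_pow h₀'nonneg hcont hint'
      measurableSet_Ioi hsub iv j) (iv.const_mul _) measurableSet_Ioi fun s hs => ?_
    rw [mul_comm]
    exact mul_le_mul_of_nonneg_right (hpow j (le_of_lt hs)) (hv s hs)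
  have htail0 : 0 ≤ ∫ s in Set.Ioi t, s⁻¹ * h₀' s := setIntegral_nonneg measurableSet_Ioi hv
  have head := mul_le_mul_of_nonneg_left cheb (inv_nonneg.2 (zero_le_one.trans ht))
  have h1 := mul_le_mul_of_nonneg_left tail (hN0 i)
  have h2 := mul_le_mul_of_nonneg_right (step i j) htail0
  rw [hFun_eq_QFun_zero, hQ, hQ]
  simp only [pow_zero, mul_one]
  linarith
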